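/- arXiv:1705.06685 — 2 statements merged into one kernel-verified Lean document; each statement's English description precedes it below -/
import Mathlib

section
/- Let k be an algebraically closed field of characteristic 0 and A = k[x,y,z]/(x²+y²+z²−1). If I is an ideal of A such that η(I) ⊆ I for every k-linear derivation η of A, then I = 0 or I = A. -/
set_option synthInstance.maxHeartbeats 1000000
set_option maxHeartbeats 1000000

open MvPolynomial

noncomputable section

/-- The coordinate ring `A = k[x,y,z]/(x² + y² + z² - 1)` of the sphere `𝕊²`. -/
abbrev SphereRing (k : Type*) [Field k] := MvPolynomial (Fin 3) k ⧸
  Ideal.span {(X 0 ^ 2 + X 1 ^ 2 + X 2 ^ 2 - 1 : MvPolynomial (Fin 3) k)}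

/-- The image of `x` in the coordinate ring of the sphere. -/
abbrev sx (k : Type*) [Field k] : SphereRing k := Ideal.Quotient.mk _ (X 0)

/-- The image of `y` in the coordinate ring of the sphere. -/
abbrev sy (k : Type*) [Field k] : SphereRing k := Ideal.Quotient.mk _ (X 1)

/-- The image of `z` in the coordinate ring of the sphere. -/
abbrev sz (k : Type*) [Field k] : SphereRing k := Ideal.Quotient.mk _ (X 2)

/-- A tangent vector `(f 0, f 1, f 2)` to the sphere defines a derivation of its coordinate ring. -/
theorem exists_derivation_sphereRing (k : Type*) [Field k] (f : Fin 3 → SphereRing k)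
    (hf : sx k * f 0 + sy k * f 1 + sz k * f 2 = 0) :
    ∃ η : Derivation k (SphereRing k) (SphereRing k),
      η (sx k) = f 0 ∧ η (sy k) = f 1 ∧ η (sz k) = f 2 := by
  set J : Ideal (MvPolynomial (Fin 3) k) :=
    Ideal.span {(X 0 ^ 2 + X 1 ^ 2 + X 2 ^ 2 - 1 : MvPolynomial (Fin 3) k)} with hJ
  set d : Derivation k (MvPolynomial (Fin 3) k) (SphereRing k) := mkDerivation k f with hd
  have hsmul : ∀ (p : MvPolynomial (Fin 3) k) (a : SphereRing k),
      p • a = Ideal.Quotient.mk J p * a := fun p a => Algebra.smul_def p a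
  have hdX : ∀ i, d (X i) = f i := fun i => mkDerivation_X k f i
  have hrel : d (X 0 ^ 2 + X 1 ^ 2 + X 2 ^ 2 - 1) = 0 := by
    have : d (X 0 ^ 2 + X 1 ^ 2 + X 2 ^ 2 - 1)
        = 2 * (sx k * f 0 + sy k * f 1 + sz k * f 2) := by
      simp only [map_add, map_sub, Derivation.map_one_eq_zero, pow_two, Derivation.leibniz, hdX,
        hsmul]
      ring
    rw [this, hf, mul_zero]
  have hker : ∀ p ∈ J, d p = 0 := by
    intro p hp
    obtain ⟨q, rfl⟩ := Ideal.mem_span_singleton'.1 hp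
    have h0 : Ideal.Quotient.mk J (X 0 ^ 2 + X 1 ^ 2 + X 2 ^ 2 - 1) = 0 :=
      Ideal.Quotient.eq_zero_iff_mem.2 (Ideal.mem_span_singleton_self _)
    rw [Derivation.leibniz, hrel, hsmul, hsmul, h0, mul_zero, zero_mul, add_zero]
  let L : SphereRing k →ₗ[k] SphereRing k :=
    (J.restrictScalars k).liftQ (d : MvPolynomial (Fin 3) k →ₗ[k] SphereRing k)
      (fun p hp => hker p hp)
  have hL : ∀ p, L (Ideal.Quotient.mk J p) = d p := fun p => rfl
  refine ⟨Derivation.mk' L ?_, hdX 0, hdX 1, hdX 2⟩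
  intro a b
  obtain ⟨p, rfl⟩ := Ideal.Quotient.mk_surjective a
  obtain ⟨q, rfl⟩ := Ideal.Quotient.mk_surjective b
  rw [← map_mul, hL, hL, hL, Derivation.leibniz, hsmul, hsmul, smul_eq_mul, smul_eq_mul]

theorem sphereRing_relation (k : Type*) [Field k] :
    sx k ^ 2 + sy k ^ 2 + sz k ^ 2 = 1 := by
  have h0 : Ideal.Quotient.mk (Ideal.span {(X 0 ^ 2 + X 1 ^ 2 + X 2 ^ 2 - 1 :
      MvPolynomial (Fin 3) k)}) (X 0 ^ 2 + X 1 ^ 2 + X 2 ^ 2 - 1) = 0 :=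
    Ideal.Quotient.eq_zero_iff_mem.2 (Ideal.mem_span_singleton_self _)
  simp only [map_add, map_sub, map_pow, map_one] at h0
  exact sub_eq_zero.1 h0

/-- The linear form `x + i y` is a nonzerodivisor on the sphere. -/
theorem eq_zero_of_isotropic_mul_eq_zero {k : Type*} [Field k] {i : k} (hi : i ^ 2 = -1)
    {a : SphereRing k} (ha : (sx k + algebraMap k _ i * sy k) * a = 0) : a = 0 := by
  obtain ⟨F, rfl⟩ := Ideal.Quotient.mk_surjective a
  set u : MvPolynomial (Fin 3) k := X 0 + C i * X 1 with hu
  let φ : MvPolynomial (Fin 3) k →ₐ[k] MvPolynomial (Fin 3) k :=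
    aeval ![-(C i * X 1), X 1, X 2]
  have hφu : φ u = 0 := by simp [φ, hu]
  have hCi : (C i : MvPolynomial (Fin 3) k) ^ 2 = -1 := by rw [← map_pow, hi]; simp
  have hφq : φ (X 0 ^ 2 + X 1 ^ 2 + X 2 ^ 2 - 1) = X 2 ^ 2 - 1 := by
    simp [φ]
    linear_combination X 1 ^ 2 * hCi
  have hdvd : ∀ G, φ G = 0 → u ∣ G := by
    intro G hG
    have hcomp : (Ideal.Quotient.mkₐ k (Ideal.span {u})).comp φ
        = Ideal.Quotient.mkₐ k (Ideal.span {u}) := by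
      refine MvPolynomial.algHom_ext fun j => ?_
      fin_cases j
      · simp only [φ, AlgHom.comp_apply, aeval_X, Ideal.Quotient.mkₐ_eq_mk]
        refine (Ideal.Quotient.eq.2 (Ideal.mem_span_singleton'.2 ⟨-1, ?_⟩))
        simp [hu]
        ring
      · simp [φ]
      · simp [φ]
    have h := DFunLike.congr_fun hcomp G
    rw [AlgHom.comp_apply, hG, map_zero, Ideal.Quotient.mkₐ_eq_mk] at h
    exact Ideal.mem_span_singleton.1 (Ideal.Quotient.eq_zero_iff_mem.1 h.symm)
  have hmem : u * F ∈ Ideal.span {(X 0 ^ 2 + X 1 ^ 2 + X 2 ^ 2 - 1 : MvPolynomial (Fin 3) k)} := by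
    rw [← Ideal.Quotient.eq_zero_iff_mem, map_mul, hu, map_add, map_mul]
    exact ha
  obtain ⟨G, hG⟩ := Ideal.mem_span_singleton.1 hmem
  have hne : (X 2 ^ 2 - 1 : MvPolynomial (Fin 3) k) ≠ 0 := by
    intro h
    simpa using congrArg (eval 0) h
  have hφG : φ G = 0 := by
    have h := congrArg φ hG
    rw [map_mul, map_mul, hφu, zero_mul, hφq] at h
    exact (mul_eq_zero.1 h.symm).resolve_left hne
  obtain ⟨G', rfl⟩ := hdvd G hφG
  have hune : u ≠ 0 := by
    intro h
    simpa [hu] using congrArg (eval ![1, 0, 0]) h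
  refine Ideal.Quotient.eq_zero_iff_mem.2 (Ideal.mem_span_singleton.2 ⟨G', ?_⟩)
  refine mul_left_cancel₀ hune ?_
  rw [hG]
  ring

/-- After inverting `u = x + i y`, every function on the sphere is a polynomial in `u` and `z`. -/
theorem exists_isotropic_pow_mul_eq {k : Type*} [Field k] [CharZero k] {i : k} (hi : i ^ 2 = -1)
    (a : SphereRing k) : ∃ (N : ℕ) (g : Polynomial (Polynomial k)),
      (sx k + algebraMap k _ i * sy k) ^ N * a =
        g.eval₂ (Polynomial.aeval (sx k + algebraMap k _ i * sy k)).toRingHom (sz k) := by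
  set j : SphereRing k := algebraMap k _ i with hj
  have hj2 : j ^ 2 = -1 := by rw [hj, ← map_pow, hi]; simp
  set u := sx k + j * sy k with hu
  have hrel := sphereRing_relation k
  set t : SphereRing k := algebraMap k _ (1 / 2) with ht
  have ht2 : 2 * t = 1 := by
    rw [ht, ← map_ofNat (algebraMap k (SphereRing k)) 2, ← map_mul]; simp
  obtain ⟨F, rfl⟩ := Ideal.Quotient.mk_surjective a
  induction F using MvPolynomial.induction_on with
  | C c =>
    refine ⟨0, Polynomial.C (Polynomial.C c), ?_⟩
    simp
    rfl
  | add p q hp hq =>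
    obtain ⟨N, g, hg⟩ := hp
    obtain ⟨M, h, hh⟩ := hq
    refine ⟨N + M, Polynomial.C (Polynomial.X ^ M) * g + Polynomial.C (Polynomial.X ^ N) * h, ?_⟩
    rw [Polynomial.eval₂_add, Polynomial.eval₂_mul, Polynomial.eval₂_mul, ← hg, ← hh]
    simp [Polynomial.eval₂_pow]
    ring
  | mul_X p n hp =>
    obtain ⟨N, g, hg⟩ := hp
    obtain ⟨h, hh⟩ : ∃ h : Polynomial (Polynomial k), u * Ideal.Quotient.mk _ (X n) =
        h.eval₂ (Polynomial.aeval u).toRingHom (sz k) := by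
      fin_cases n
      · refine ⟨Polynomial.C (Polynomial.C (1 / 2)) *
          (Polynomial.C (Polynomial.X ^ 2) + 1 - Polynomial.X ^ 2), ?_⟩
        have : u * sx k = t * (u ^ 2 + 1 - sz k ^ 2) := by
          rw [hu]
          linear_combination (-(sx k ^ 2 + j * sx k * sy k)) * ht2 + t * hrel - t * sy k ^ 2 * hj2
        simpa [Polynomial.eval₂_mul, Polynomial.eval₂_pow, ht, hj] using this
      · refine ⟨Polynomial.C (Polynomial.C (1 / 2) * Polynomial.C (-i)) *
          (Polynomial.C (Polynomial.X ^ 2) - 1 + Polynomial.X ^ 2), ?_⟩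
        have : u * sy k = -(t * j) * (u ^ 2 - 1 + sz k ^ 2) := by
          rw [hu]
          linear_combination (-(sx k * sy k + j * sy k ^ 2)) * ht2 + t * j * hrel +
            t * (2 * sx k * sy k + j * sy k ^ 2) * hj2
        simpa [Polynomial.eval₂_mul, Polynomial.eval₂_pow, ht, hj] using this
      · refine ⟨Polynomial.C Polynomial.X * Polynomial.X, ?_⟩
        simp [Polynomial.eval₂_mul]
    refine ⟨N + 1, g * h, ?_⟩
    rw [Polynomial.eval₂_mul, ← hg, ← hh, map_mul]
    ring

theorem Derivation.eval₂_aeval_eq {k A : Type*} [CommRing k] [CommRing A] [Algebra k A]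
    (D : Derivation k A A) {u : A} (hu : D u = 0) (z : A) (g : Polynomial (Polynomial k)) :
    D (g.eval₂ (Polynomial.aeval u).toRingHom z) =
      g.derivative.eval₂ (Polynomial.aeval u).toRingHom z * D z := by
  induction g using Polynomial.induction_on' with
  | add p q hp hq => simp only [Polynomial.eval₂_add, map_add, hp, hq, add_mul]
  | monomial n p =>
    have hp : D (Polynomial.aeval u p) = 0 := by rw [Derivation.map_aeval, hu, smul_zero]
    simp [Polynomial.derivative_monomial, Polynomial.eval₂_monomial, Derivation.leibniz,
      Derivation.leibniz_pow, hp]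
    ring

/-- An ideal stable under a derivation killing `u` and sending `z` to `u` contains a nonzero
polynomial in `u` as soon as it contains a nonzero polynomial expression in `u` and `z`. -/
theorem exists_aeval_mem_of_eval₂_mem {k A : Type*} [Field k] [CharZero k] [CommRing A]
    [Algebra k A] {I : Ideal A} {D : Derivation k A A} (hD : ∀ a ∈ I, D a ∈ I) {u z : A}
    (hu : D u = 0) (hz : D z = u) (g : Polynomial (Polynomial k)) (hg : g ≠ 0)
    (hgI : g.eval₂ (Polynomial.aeval u).toRingHom z ∈ I) :
    ∃ p : Polynomial k, p ≠ 0 ∧ Polynomial.aeval u p ∈ I := by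
  induction hn : g.natDegree generalizing g with
  | zero =>
    obtain ⟨p, rfl⟩ := Polynomial.natDegree_eq_zero.1 hn
    exact ⟨p, by simpa using hg, by simpa using hgI⟩
  | succ n ih =>
    have hdeg : g.derivative.natDegree = n := by
      rw [Polynomial.natDegree_derivative, hn, Nat.add_sub_cancel]
    have hne : g.derivative ≠ 0 := by
      intro h
      have := Polynomial.derivative_eq_zero.1 h
      omega
    refine ih (Polynomial.C Polynomial.X * g.derivative)
      (mul_ne_zero (by simp) hne) ?_ ?_
    · have h := hD _ hgI
      rw [Derivation.eval₂_aeval_eq D hu, hz] at h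
      simpa [Polynomial.eval₂_mul, mul_comm] using h
    · rw [Polynomial.natDegree_C_mul Polynomial.X_ne_zero, hdeg]

/-- An ideal of a `k`-algebra containing a nonzero polynomial in `u`, and containing `p'(u)` whenever
it contains `p(u)`, is the unit ideal. -/
theorem Ideal.eq_top_of_aeval_mem {k A : Type*} [Field k] [CharZero k] [CommRing A]
    [Algebra k A] {I : Ideal A} {u : A}
    (hI : ∀ p : Polynomial k, Polynomial.aeval u p ∈ I → Polynomial.aeval u p.derivative ∈ I)
    (p : Polynomial k) (hp : p ≠ 0) (hpI : Polynomial.aeval u p ∈ I) : I = ⊤ := by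
  induction hn : p.natDegree generalizing p with
  | zero =>
    obtain ⟨c, rfl⟩ := Polynomial.natDegree_eq_zero.1 hn
    have hc : c ≠ 0 := by simpa using hp
    rw [Polynomial.aeval_C] at hpI
    exact I.eq_top_of_isUnit_mem hpI ((IsUnit.mk0 c hc).map _)
  | succ n ih =>
    refine ih p.derivative ?_ (hI p hpI) ?_
    · intro h
      have := Polynomial.derivative_eq_zero.1 h
      omega
    · rw [Polynomial.natDegree_derivative, hn, Nat.add_sub_cancel]

/-- Simplicity of the rank-1 tensor module `A = A⁰` on the sphere: an ideal of the
coordinate ring of the sphere invariant under all vector fields is `0` or `A`. -/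
theorem sphere_ring_simple_AV_module
    (k : Type*) [Field k] [IsAlgClosed k] [CharZero k]
    (I : Ideal (SphereRing k))
    (hI : ∀ η : Derivation k (SphereRing k) (SphereRing k), ∀ a ∈ I, η a ∈ I) :
    I = ⊥ ∨ I = ⊤ := by
  rw [or_iff_not_imp_left]
  intro hne
  obtain ⟨f, hfI, hf⟩ := Submodule.exists_mem_ne_zero_of_ne_bot hne
  obtain ⟨i, hi⟩ := IsAlgClosed.exists_pow_nat_eq (-1 : k) (n := 2) (by norm_num)
  set j : SphereRing k := algebraMap k _ i with hj
  have hj2 : j ^ 2 = -1 := by rw [hj, ← map_pow, hi]; simp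
  have hdj : ∀ η : Derivation k (SphereRing k) (SphereRing k), η j = 0 :=
    fun η => η.map_algebraMap i
  have hrel := sphereRing_relation k
  obtain ⟨D, hDx, hDy, hDz⟩ := exists_derivation_sphereRing k
    ![-sz k, -(j * sz k), sx k + j * sy k] (by simp; ring)
  obtain ⟨E, hEx, hEy, -⟩ := exists_derivation_sphereRing k
    ![-sz k, j * sz k, sx k - j * sy k] (by simp; ring)
  obtain ⟨H, hHx, hHy, -⟩ := exists_derivation_sphereRing k
    ![j * sy k, -(j * sx k), 0] (by simp; ring)
  simp only [Matrix.cons_val] at hDx hDy hDz hEx hEy hHx hHy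
  set u := sx k + j * sy k with hu
  have hDu : D u = 0 := by
    rw [hu, map_add, Derivation.leibniz, hdj, hDx, hDy, smul_zero, add_zero, smul_eq_mul]
    linear_combination -sz k * hj2
  have hEu : E u = -(2 * sz k) := by
    rw [hu, map_add, Derivation.leibniz, hdj, hEx, hEy, smul_zero, add_zero, smul_eq_mul]
    linear_combination sz k * hj2
  have hHu : H u = u := by
    rw [hu, map_add, Derivation.leibniz, hdj, hHx, hHy, smul_zero, add_zero, smul_eq_mul]
    linear_combination -sx k * hj2
  have hreg : ∀ N : ℕ, u ^ N * f ≠ 0 := by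
    intro N
    induction N with
    | zero => simpa using hf
    | succ N ih =>
      intro h
      rw [pow_succ' u, mul_assoc] at h
      exact ih (eq_zero_of_isotropic_mul_eq_zero hi h)
  obtain ⟨N, g, hg⟩ := exists_isotropic_pow_mul_eq hi f
  have hg0 : g ≠ 0 := by
    rintro rfl
    exact hreg N (by rw [hg, Polynomial.eval₂_zero])
  obtain ⟨p, hp, hpI⟩ := exists_aeval_mem_of_eval₂_mem (hI D) hDu hDz g hg0
    (hg ▸ I.mul_mem_left _ hfI)
  refine Ideal.eq_top_of_aeval_mem (fun q hq => ?_) p hp hpI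
  have hE := hI E _ hq
  have hH := hI H _ hq
  rw [Derivation.map_aeval, hEu, smul_eq_mul] at hE
  rw [Derivation.map_aeval, hHu, smul_eq_mul] at hH
  have ht2 : 2 * algebraMap k (SphereRing k) (1 / 2) = 1 := by
    rw [← map_ofNat (algebraMap k (SphereRing k)) 2, ← map_mul]; simp
  set t : SphereRing k := algebraMap k _ (1 / 2)
  set b := Polynomial.aeval u q.derivative
  have hb : b = (sx k - j * sy k) * (b * u) + (-(t * sz k)) * (b * -(2 * sz k)) := by
    rw [hu]
    linear_combination -b * hrel + b * sy k ^ 2 * hj2 - b * sz k ^ 2 * ht2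
  rw [hb]
  exact I.add_mem (I.mul_mem_left _ hH) (I.mul_mem_left _ hE)


end
end

section
/- Let k be an algebraically closed field of characteristic 0 and A = k[x,y,z]/(x²+y²+z²−1). If I ⊆ Der_k(A) is an A-submodule of the module of derivations such that [η, δ] ∈ I for every η ∈ Der_k(A) and every δ ∈ I, then I = 0 or I = Der_k(A). That is, the Lie algebra of vector fields on the sphere is a simple AV-module under multiplication by A and the adjoint action of Der_k(A). -/
set_option synthInstance.maxHeartbeats 1000000
set_option maxHeartbeats 1000000

open MvPolynomial

noncomputable section

section General

variable {k A : Type*} [CommRing k] [CommRing A] [Algebra k A]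

/-- If a `k`-algebra has no nontrivial ideal stable under all derivations, then its module of
derivations has no nontrivial submodule stable under the adjoint action. -/
theorem eq_bot_or_eq_top_of_lie_mem
    (hA : ∀ J : Ideal A, (∀ η : Derivation k A A, ∀ f ∈ J, η f ∈ J) → J = ⊥ ∨ J = ⊤)
    (I : Submodule A (Derivation k A A))
    (hI : ∀ η : Derivation k A A, ∀ δ ∈ I, ⁅η, δ⁆ ∈ I) : I = ⊥ ∨ I = ⊤ := by
  let S : Set A := {g | ∃ δ ∈ I, ∃ f, δ f = g}
  have hS : ∀ η : Derivation k A A, ∀ g ∈ Ideal.span S, η g ∈ Ideal.span S := by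
    intro η g hg
    induction hg using Submodule.span_induction with
    | mem g hg =>
      obtain ⟨δ, hδ, f, rfl⟩ := hg
      have h : η (δ f) = ⁅η, δ⁆ f + δ (η f) := by rw [Derivation.commutator_apply]; ring
      rw [h]
      exact add_mem (Ideal.subset_span ⟨_, hI η δ hδ, f, rfl⟩)
        (Ideal.subset_span ⟨δ, hδ, _, rfl⟩)
    | zero => simp
    | add a b _ _ ha hb => rw [map_add]; exact add_mem ha hb
    | smul a b hb hηb =>
      rw [smul_eq_mul, Derivation.leibniz, smul_eq_mul, smul_eq_mul]
      exact add_mem (Ideal.mul_mem_left _ _ hηb) (Ideal.mul_mem_right _ _ hb)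
  have hSI : ∀ g ∈ Ideal.span S, ∀ η : Derivation k A A, g • η ∈ I := by
    intro g hg η
    induction hg using Submodule.span_induction with
    | mem g hg =>
      obtain ⟨δ, hδ, f, rfl⟩ := hg
      have h : δ f • η = f • ⁅η, δ⁆ - ⁅f • η, δ⁆ := by
        ext a
        simp only [Derivation.smul_apply, Derivation.sub_apply, Derivation.commutator_apply,
          smul_eq_mul, Derivation.leibniz]
        ring
      rw [h]
      exact sub_mem (I.smul_mem f (hI η δ hδ)) (hI _ δ hδ)
    | zero => simp
    | add a b _ _ ha hb => rw [add_smul]; exact add_mem ha hb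
    | smul a b _ hb => rw [smul_eq_mul, mul_smul]; exact I.smul_mem a hb
  refine (hA _ hS).imp (fun h ↦ ?_) (fun h ↦ ?_)
  · refine (Submodule.eq_bot_iff _).2 fun δ hδ ↦ Derivation.ext fun f ↦ ?_
    have hf : δ f ∈ Ideal.span S := Ideal.subset_span ⟨δ, hδ, f, rfl⟩
    simpa [h] using hf
  · refine (Submodule.eq_top_iff').2 fun η ↦ ?_
    simpa using hSI 1 (h ▸ Submodule.mem_top) η

end General

section Triple

variable {k A : Type*} [Field k] [CommRing A] [Algebra k A] {u v z : A}
  (J : Ideal A)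

theorem Ideal.one_mem_of_pow_mem_of_derivation_mem [CharZero k] (F : Derivation k A A)
    (hF : ∀ f ∈ J, F f ∈ J) (huvz : u * v + z ^ 2 = 1) (hFu : F u = -2 * z) {n : ℕ}
    (hn : u ^ n ∈ J) : (1 : A) ∈ J := by
  induction n with
  | zero => simpa using hn
  | succ n ih =>
    refine ih ?_
    have h := hF _ hn
    rw [Derivation.leibniz_pow, hFu, Nat.add_sub_cancel] at h
    have hc : (-2 * (n + 1 : k)) ≠ 0 :=
      mul_ne_zero (by norm_num) (Nat.cast_add_one_ne_zero n)
    have hz : u ^ n * z ∈ J := by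
      have h' := Submodule.smul_of_tower_mem J (-2 * (n + 1 : k))⁻¹ h
      have : (n + 1) • u ^ n • (-2 * z) = (-2 * (n + 1 : k)) • (u ^ n * z) := by
        rw [nsmul_eq_mul, smul_eq_mul, Algebra.smul_def, map_mul, map_neg, map_add,
          map_natCast, map_ofNat, map_one]
        push_cast
        ring
      rwa [this, inv_smul_smul₀ hc] at h'
    have : u ^ n = u ^ (n + 1) * v + u ^ n * z * z := by
      linear_combination -u ^ n * huvz
    rw [this]
    exact add_mem (J.mul_mem_right _ hn) (J.mul_mem_right _ hz)

namespace Polynomial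

theorem exists_pow_mem_of_aeval_mem [CharZero k] (H : Derivation k A A)
    (hH : ∀ f ∈ J, H f ∈ J) (hHu : H u = u) {q : Polynomial k} (hq : q ≠ 0)
    (hqJ : aeval u q ∈ J) : ∃ n, u ^ n ∈ J := by
  induction hd : q.natDegree using Nat.strong_induction_on generalizing q with
  | _ d ih =>
    let r : Polynomial k := (d : k) • q - X * derivative q
    have hr : aeval u r ∈ J := by
      have h := hH _ hqJ
      rw [Derivation.map_aeval, hHu] at h
      have : aeval u r = (d : k) • aeval u q - aeval u (derivative q) • u := by
        simp only [r, map_sub, map_smul, map_mul, aeval_X, smul_eq_mul]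
        ring
      rw [this]
      exact sub_mem (Submodule.smul_of_tower_mem J _ hqJ) h
    have hcoeff : ∀ j, r.coeff j = ((d : k) - j) * q.coeff j := by
      rintro (_ | j)
      · simp [r]
      · simp only [r, coeff_sub, coeff_smul, smul_eq_mul, coeff_X_mul, coeff_derivative]
        push_cast
        ring
    by_cases h0 : r = 0
    · refine ⟨d, ?_⟩
      have hmon : q = monomial d q.leadingCoeff := by
        ext j
        rw [coeff_monomial]
        split_ifs with hj
        · rw [← hj, ← hd, leadingCoeff]
        · have := hcoeff j
          rw [h0, coeff_zero, eq_comm, mul_eq_zero, sub_eq_zero, Nat.cast_inj] at this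
          exact this.resolve_left hj
      rw [hmon, aeval_monomial, ← Algebra.smul_def] at hqJ
      have := Submodule.smul_of_tower_mem J q.leadingCoeff⁻¹ hqJ
      rwa [inv_smul_smul₀ (leadingCoeff_ne_zero.2 hq)] at this
    · refine ih _ ?_ h0 hr rfl
      have hle : r.natDegree ≤ d := natDegree_le_iff_coeff_eq_zero.2 fun j hj ↦ by
        rw [hcoeff, coeff_eq_zero_of_natDegree_lt (hd ▸ hj), mul_zero]
      refine lt_of_le_of_ne hle fun h ↦ h0 (leadingCoeff_eq_zero.1 ?_)
      rw [leadingCoeff, h, hcoeff, sub_self, zero_mul]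

theorem derivation_eval₂_aeval (E : Derivation k A A) (hEu : E u = 0)
    (p : Polynomial (Polynomial k)) :
    E (p.eval₂ (aeval u : Polynomial k →ₐ[k] A).toRingHom z) =
      p.derivative.eval₂ (aeval u : Polynomial k →ₐ[k] A).toRingHom z * E z := by
  induction p using Polynomial.induction_on' with
  | add p q hp hq => simp only [eval₂_add, map_add, hp, hq, add_mul]
  | monomial n a =>
    simp only [eval₂_monomial, derivative_monomial, Derivation.leibniz, Derivation.leibniz_pow,
      AlgHom.toRingHom_eq_coe, RingHom.coe_coe, Derivation.map_aeval, hEu, smul_eq_mul, map_mul,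
      map_natCast, nsmul_eq_mul]
    ring

theorem exists_aeval_mem_of_eval₂_mem [CharZero k] (E : Derivation k A A)
    (hE : ∀ f ∈ J, E f ∈ J) (hEu : E u = 0) (hEz : E z = u) {p : Polynomial (Polynomial k)}
    (hp : p ≠ 0)
    (hpJ : p.eval₂ (aeval u : Polynomial k →ₐ[k] A).toRingHom z ∈ J) :
    ∃ q : Polynomial k, q ≠ 0 ∧ aeval u q ∈ J := by
  induction hd : p.natDegree using Nat.strong_induction_on generalizing p with
  | _ d ih =>
    by_cases h0 : d = 0
    · rw [h0] at hd
      rw [eq_C_of_natDegree_eq_zero hd] at hp hpJ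
      exact ⟨p.coeff 0, by simpa using hp, by simpa using hpJ⟩
    · have hpd : p.natDegree ≠ 0 := hd ▸ h0
      have h := hE _ hpJ
      rw [derivation_eval₂_aeval E hEu, hEz] at h
      refine ih (C X * derivative p).natDegree ?_ ?_ ?_ rfl
      · rw [natDegree_C_mul X_ne_zero, ← hd]
        exact natDegree_derivative_lt hpd
      · exact mul_ne_zero (by simp) fun h ↦ hpd (derivative_eq_zero.1 h)
      · rw [eval₂_mul, eval₂_C, mul_comm]
        simpa using h

theorem exists_pow_mul_eq_eval₂ (huvz : u * v + z ^ 2 = 1)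
    (hgen : Algebra.adjoin k {u, v, z} = ⊤) (f : A) :
    ∃ (n : ℕ) (p : Polynomial (Polynomial k)),
      u ^ n * f = p.eval₂ (aeval u : Polynomial k →ₐ[k] A).toRingHom z := by
  have hf : f ∈ Algebra.adjoin k {u, v, z} := hgen ▸ Algebra.mem_top
  induction hf using Algebra.adjoin_induction with
  | mem f hf =>
    obtain rfl | rfl | rfl := hf
    · exact ⟨0, C X, by simp⟩
    · refine ⟨1, 1 - X ^ 2, ?_⟩
      simp only [eval₂_sub, eval₂_one, eval₂_pow, eval₂_X]
      linear_combination huvz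
    · exact ⟨0, X, by simp⟩
  | algebraMap a => exact ⟨0, C (C a), by simp⟩
  | add f g _ _ hf hg =>
    obtain ⟨m, p, hp⟩ := hf
    obtain ⟨n, q, hq⟩ := hg
    refine ⟨m + n, C (X ^ n) * p + C (X ^ m) * q, ?_⟩
    rw [eval₂_add, eval₂_mul, eval₂_mul, ← hp, ← hq, eval₂_C, eval₂_C]
    simp only [AlgHom.toRingHom_eq_coe, RingHom.coe_coe, map_pow, aeval_X]
    ring
  | mul f g _ _ hf hg =>
    obtain ⟨m, p, hp⟩ := hf
    obtain ⟨n, q, hq⟩ := hg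
    refine ⟨m + n, p * q, ?_⟩
    rw [eval₂_mul, ← hp, ← hq]
    ring

end Polynomial

/-- The algebra generated by `u, v, z` with `u * v + z ^ 2 = 1` and `u` regular has no nontrivial
ideal stable under the standard `sl₂`-triple of derivations. -/
theorem Ideal.eq_bot_or_eq_top_of_derivation_mem [CharZero k] (E F H : Derivation k A A)
    (hE : ∀ f ∈ J, E f ∈ J) (hF : ∀ f ∈ J, F f ∈ J) (hH : ∀ f ∈ J, H f ∈ J)
    (huvz : u * v + z ^ 2 = 1) (hgen : Algebra.adjoin k {u, v, z} = ⊤)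
    (hu : ∀ f, u * f = 0 → f = 0) (hEu : E u = 0) (hEz : E z = u) (hFu : F u = -2 * z)
    (hHu : H u = u) : J = ⊥ ∨ J = ⊤ := by
  refine or_iff_not_imp_left.2 fun hJ ↦ ?_
  obtain ⟨f, hfJ, hf⟩ := Submodule.exists_mem_ne_zero_of_ne_bot hJ
  obtain ⟨n, p, hp⟩ := Polynomial.exists_pow_mul_eq_eval₂ (k := k) huvz hgen f
  have hp0 : p ≠ 0 := by
    rintro rfl
    rw [Polynomial.eval₂_zero] at hp
    induction n with
    | zero => exact hf (by simpa using hp)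
    | succ n ih => exact ih (hu _ (by rw [← hp]; ring))
  obtain ⟨q, hq, hqJ⟩ := Polynomial.exists_aeval_mem_of_eval₂_mem J E hE hEu hEz hp0
    (hp ▸ J.mul_mem_left _ hfJ)
  obtain ⟨m, hm⟩ := Polynomial.exists_pow_mem_of_aeval_mem J H hH hHu hq hqJ
  exact (Ideal.eq_top_iff_one J).2 (J.one_mem_of_pow_mem_of_derivation_mem F hF huvz hFu hm)

end Triple

namespace SphereRing

variable {k : Type*} [Field k]

theorem sq_add_sq_add_sq : sx k ^ 2 + sy k ^ 2 + sz k ^ 2 = 1 := by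
  have h : (Ideal.Quotient.mk (Ideal.span {(X 0 ^ 2 + X 1 ^ 2 + X 2 ^ 2 - 1 :
      MvPolynomial (Fin 3) k)})) (X 0 ^ 2 + X 1 ^ 2 + X 2 ^ 2 - 1) = 0 :=
    Ideal.Quotient.eq_zero_iff_mem.2 (Ideal.mem_span_singleton_self _)
  rwa [map_sub, sub_eq_zero] at h

/-- A polynomial vector field tangent to the sphere restricts to a derivation of its coordinate
ring. -/
theorem exists_derivation (g : Fin 3 → MvPolynomial (Fin 3) k)
    (hg : X 0 * g 0 + X 1 * g 1 + X 2 * g 2 = 0) :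
    ∃ D : Derivation k (SphereRing k) (SphereRing k),
      ∀ i, D (Ideal.Quotient.mk _ (X i)) = Ideal.Quotient.mk _ (g i) := by
  let J : Ideal (MvPolynomial (Fin 3) k) := Ideal.span {X 0 ^ 2 + X 1 ^ 2 + X 2 ^ 2 - 1}
  have hd : ∀ p, Ideal.Quotient.mkₐ k J p = 0 →
      Ideal.Quotient.mkₐ k J (mkDerivation k g p) = 0 := by
    intro p hp
    rw [Ideal.Quotient.mkₐ_eq_mk, Ideal.Quotient.eq_zero_iff_mem,
      Ideal.mem_span_singleton] at hp ⊢
    obtain ⟨q, rfl⟩ := hp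
    refine ⟨mkDerivation k g q, ?_⟩
    simp only [Derivation.leibniz, Derivation.leibniz_pow, map_add, map_sub, mkDerivation_X,
      Derivation.map_one_eq_zero, smul_eq_mul, nsmul_eq_mul]
    push_cast
    linear_combination (2 * q) * hg
  refine ⟨Derivation.liftOfSurjective (Ideal.Quotient.mkₐ_surjective k J) hd, fun i ↦ ?_⟩
  have h := Derivation.liftOfSurjective_apply (Ideal.Quotient.mkₐ_surjective k J) hd (X i)
  rw [mkDerivation_X] at h
  exact h

theorem eq_zero_of_isotropic_mul_eq_zero (i : k) (f : SphereRing k)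
    (hf : (sx k + algebraMap k _ i * sy k) * f = 0) : f = 0 := by
  obtain ⟨p, rfl⟩ := Ideal.Quotient.mk_surjective f
  let U : MvPolynomial (Fin 3) k := X 0 + C i * X 1
  have hU : U ≠ 0 := fun h ↦ by
    have := congrArg (eval ![1, 0, 0]) h
    simp [U] at this
  have hUp : Ideal.Quotient.mk _ (U * p) = (0 : SphereRing k) := by
    rw [← hf, map_mul, map_add, map_mul]
    rfl
  rw [Ideal.Quotient.eq_zero_iff_mem, Ideal.mem_span_singleton] at hUp ⊢
  obtain ⟨q, hq⟩ := hUp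
  let π : MvPolynomial (Fin 3) k →ₐ[k] MvPolynomial (Fin 3) k :=
    aeval ![-(C i * X 1), X 1, X 2]
  have hπU : π U = 0 := by simp [π, U]
  have hπq : π q = 0 := by
    have h := congrArg π hq
    rw [map_mul, hπU, zero_mul, map_mul, eq_comm, mul_eq_zero] at h
    refine h.resolve_left fun h ↦ ?_
    have := congrArg (eval ![0, 0, 0]) h
    simp [π] at this
  have hUq : U ∣ q := by
    have hcomp : (Ideal.Quotient.mkₐ k (Ideal.span {U})).comp π =
        Ideal.Quotient.mkₐ k (Ideal.span {U}) := by
      ext j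
      fin_cases j
      · refine (Ideal.Quotient.eq.2 (Ideal.mem_span_singleton.2 ⟨-1, ?_⟩))
        simp [π, U]
        ring
      · simp [π]
      · simp [π]
    have h := DFunLike.congr_fun hcomp q
    rw [AlgHom.comp_apply, hπq, map_zero, eq_comm, Ideal.Quotient.mkₐ_eq_mk,
      Ideal.Quotient.eq_zero_iff_mem, Ideal.mem_span_singleton] at h
    exact h
  obtain ⟨r, rfl⟩ := hUq
  exact ⟨r, mul_left_cancel₀ hU (by rw [hq]; ring)⟩

theorem adjoin_isotropic_eq_top [CharZero k] {i : k} (hi : i ^ 2 = -1) :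
    Algebra.adjoin k {sx k + algebraMap k _ i * sy k, sx k - algebraMap k _ i * sy k, sz k} =
      ⊤ := by
  set S := Algebra.adjoin k
    {sx k + algebraMap k _ i * sy k, sx k - algebraMap k _ i * sy k, sz k}
  have hu : sx k + algebraMap k _ i * sy k ∈ S := Algebra.subset_adjoin (by simp)
  have hv : sx k - algebraMap k _ i * sy k ∈ S := Algebra.subset_adjoin (by simp)
  have hz : sz k ∈ S := Algebra.subset_adjoin (by simp)
  have hiA : algebraMap k (SphereRing k) i ^ 2 = -1 := by rw [← map_pow, hi]; simp
  have h2 : algebraMap k (SphereRing k) 2⁻¹ * 2 = 1 := by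
    rw [← map_ofNat (algebraMap k (SphereRing k)) 2, ← map_mul,
      inv_mul_cancel₀ two_ne_zero, map_one]
  have hx : sx k ∈ S := by
    have := S.smul_mem (add_mem hu hv) (2⁻¹ : k)
    rw [Algebra.smul_def] at this
    convert this using 1
    linear_combination -sx k * h2
  have hy : sy k ∈ S := by
    have := S.smul_mem (S.smul_mem (sub_mem hv hu) (2⁻¹ : k)) i
    rw [Algebra.smul_def, Algebra.smul_def] at this
    convert this using 1
    linear_combination -sy k * h2 + algebraMap k _ 2⁻¹ * 2 * sy k * hiA
  refine eq_top_iff.2 fun f _ ↦ ?_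
  obtain ⟨p, rfl⟩ := Ideal.Quotient.mk_surjective f
  induction p using MvPolynomial.induction_on with
  | C a => exact S.algebraMap_mem a
  | add p q hp hq => rw [map_add]; exact add_mem (hp trivial) (hq trivial)
  | mul_X p j hp =>
    rw [map_mul]
    refine mul_mem (hp trivial) ?_
    fin_cases j
    exacts [hx, hy, hz]

theorem ideal_eq_bot_or_eq_top_of_derivation_mem [CharZero k] {i : k} (hi : i ^ 2 = -1)
    (J : Ideal (SphereRing k))
    (hJ : ∀ η : Derivation k (SphereRing k) (SphereRing k), ∀ f ∈ J, η f ∈ J) :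
    J = ⊥ ∨ J = ⊤ := by
  have hiA : algebraMap k (SphereRing k) i ^ 2 = -1 := by rw [← map_pow, hi]; simp
  have hmk : ∀ a : k, Ideal.Quotient.mk (Ideal.span {(X 0 ^ 2 + X 1 ^ 2 + X 2 ^ 2 - 1 :
      MvPolynomial (Fin 3) k)}) (C a) = algebraMap k (SphereRing k) a := fun _ ↦ rfl
  obtain ⟨E, hE⟩ := exists_derivation (k := k) ![-X 2, -(C i * X 2), X 0 + C i * X 1]
    (by simp; ring)
  obtain ⟨F, hF⟩ := exists_derivation (k := k) ![-X 2, C i * X 2, X 0 - C i * X 1]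
    (by simp; ring)
  obtain ⟨H, hH⟩ := exists_derivation (k := k) ![C i * X 1, -(C i * X 0), 0]
    (by simp; ring)
  have hD : ∀ D : Derivation k (SphereRing k) (SphereRing k),
      D (sx k + algebraMap k _ i * sy k) = D (sx k) + algebraMap k _ i * D (sy k) := by
    intro D
    simp [Derivation.leibniz]
  refine J.eq_bot_or_eq_top_of_derivation_mem E F H (hJ E) (hJ F) (hJ H) ?_
    (adjoin_isotropic_eq_top hi) (eq_zero_of_isotropic_mul_eq_zero i) ?_ ?_ ?_ ?_
  · linear_combination sq_add_sq_add_sq (k := k) - sy k ^ 2 * hiA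
  · rw [hD, hE, hE]
    simp [hmk]
    linear_combination -sz k * hiA
  · rw [hE]
    simp [hmk]
  · rw [hD, hF, hF]
    simp [hmk]
    linear_combination sz k * hiA
  · rw [hD, hH, hH]
    simp [hmk]
    linear_combination -sx k * hiA

end SphereRing

/-- Simplicity of the module of vector fields on the sphere as an `AV`-module: an
`A`-submodule of `Der_k(A)` invariant under the adjoint action of all vector fields is
`0` or everything. -/
theorem sphere_vector_fields_simple_AV_module
    (k : Type*) [Field k] [IsAlgClosed k] [CharZero k]
    (I : Submodule (SphereRing k) (Derivation k (SphereRing k) (SphereRing k)))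
    (hI : ∀ η : Derivation k (SphereRing k) (SphereRing k), ∀ δ ∈ I, ⁅η, δ⁆ ∈ I) :
    I = ⊥ ∨ I = ⊤ := by
  obtain ⟨i, hi⟩ := IsAlgClosed.exists_pow_nat_eq (-1 : k) (n := 2) (by norm_num)
  exact eq_bot_or_eq_top_of_lie_mem
    (fun J hJ ↦ SphereRing.ideal_eq_bot_or_eq_top_of_derivation_mem hi J hJ) I hI

end
end
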